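/- arXiv:2408.01238 — 2 statements merged into one kernel-verified Lean document; each statement's English description precedes it below -/
import Mathlib

section
/- Let J ≥ 0 and m ∈ ℕ with 2m > J + 1 + d/2. Then there is a constant C_{J,m} such that for each f ∈ C^{2m+1}(T^d) and all n ≥ 1, ‖ex_n f - f‖_{H_J} ≤ (C_{J,m}/n) ‖f‖_{C^{2m+1}}; i.e. trigonometric interpolation on a grid with (2n+1)^d points approximates smooth functions at rate 1/n in H_J. -/
open scoped BigOperators
open Real

noncomputable section

/-- The discrete `d`-dimensional torus with `(2n+1)^d` points. -/
abbrev DTorus (d n : ℕ) := Fin d → ZMod (2 * n + 1)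

/-- Squared euclidean norm `|k|²` of a lattice vector `k ∈ ℤ^d`. -/
def latNormSq (d : ℕ) (k : Fin d → ℤ) : ℝ := ∑ j, ((k j : ℝ)) ^ 2

/-- Sobolev weight `(1+|k|²)^J`. -/
def sobWeight (d : ℕ) (J : ℝ) (k : Fin d → ℤ) : ℝ := (1 + latNormSq d k) ^ J

/-- Squared Sobolev norm of an element of `H_J(T^d)` represented by its Fourier
coefficient sequence. -/
def sobNormSq (d : ℕ) (J : ℝ) (c : (Fin d → ℤ) → ℂ) : ℝ :=
  ∑' k, sobWeight d J k * ‖c k‖ ^ 2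

/-- Sobolev norm. -/
def sobNorm (d : ℕ) (J : ℝ) (c : (Fin d → ℤ) → ℂ) : ℝ := Real.sqrt (sobNormSq d J c)

/-- The character `ς_k(y) = e^{i k·y}`. -/
def charFun (d : ℕ) (k : Fin d → ℤ) (y : Fin d → ℝ) : ℂ :=
  Complex.exp (Complex.I * (∑ j, (k j : ℝ) * y j))

/-- The point of `T^d` corresponding to a lattice point of the discrete torus. -/
def discPt (d n : ℕ) (x : DTorus d n) : Fin d → ℝ :=
  fun j => 2 * π * ((x j).val : ℝ) / (2 * (n : ℝ) + 1)

/-- Normalized discrete inner product on `L_2(T_n^d)` (complex-valued version). -/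
def dInner (d n : ℕ) (f g : DTorus d n → ℂ) : ℂ :=
  (((2 * (n : ℝ) + 1) ^ d : ℝ) : ℂ)⁻¹ * ∑ x : DTorus d n, f x * (starRingEnd ℂ) (g x)

/-- Squared discrete `L²` norm `‖f‖²_n`. -/
def dNormSq (d n : ℕ) (f : DTorus d n → ℂ) : ℝ :=
  ((2 * (n : ℝ) + 1) ^ d)⁻¹ * ∑ x : DTorus d n, ‖f x‖ ^ 2

/-- Fourier coefficient sequence of the trigonometric interpolation
`ex_n f = Σ_{k ∈ {-n,…,n}^d} ⟨f, ς_k⟩_n ς_k`. -/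
def exCoef (d n : ℕ) (f : DTorus d n → ℂ) : (Fin d → ℤ) → ℂ :=
  fun k => if ∀ j, |k j| ≤ (n : ℤ) then
    dInner d n f (fun x => charFun d k (discPt d n x)) else 0

/-- Truncation of a coefficient sequence to the cube `{-n,…,n}^d` (i.e. `pr_n`). -/
def trunc (d n : ℕ) (c : (Fin d → ℤ) → ℂ) : (Fin d → ℤ) → ℂ :=
  fun k => if ∀ j, |k j| ≤ (n : ℤ) then c k else 0

/-- The cube `{-n,…,n}^d ⊂ ℤ^d`. -/
def cube (d n : ℕ) : Finset (Fin d → ℤ) :=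
  Fintype.piFinset fun _ => Finset.Icc (-(n : ℤ)) (n : ℤ)

/-- The restriction of the Fourier projection `pr_n g` to the discrete torus. -/
def prDisc (d n : ℕ) (c : (Fin d → ℤ) → ℂ) : DTorus d n → ℂ :=
  fun x => ∑ k ∈ cube d n, c k * charFun d k (discPt d n x)

/-- `L²(T^d)` inner product in Fourier coordinates. -/
def seqInner (d : ℕ) (c₁ c₂ : (Fin d → ℤ) → ℂ) : ℂ :=
  ∑' k, c₁ k * (starRingEnd ℂ) (c₂ k)

open MeasureTheory

/-- `2π`-periodicity of a function on `ℝ^d` in every coordinate. -/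
def IsPeriodic (d : ℕ) (g : (Fin d → ℝ) → ℂ) : Prop :=
  ∀ (y : Fin d → ℝ) (j : Fin d), g (Function.update y j (y j + 2 * π)) = g y

/-- Fourier coefficient `⟨g, ς_k⟩` with respect to the normalized Lebesgue measure. -/
def fourierCoeff' (d : ℕ) (g : (Fin d → ℝ) → ℂ) (k : Fin d → ℤ) : ℂ :=
  (((2 * π) ^ d : ℝ) : ℂ)⁻¹ *
    ∫ y in Set.univ.pi fun _ : Fin d => Set.Icc (0 : ℝ) (2 * π),
      g y * (starRingEnd ℂ) (charFun d k y)

local instance instMSUC : MeasureSpace UnitAddCircle := ⟨AddCircle.haarAddCircle⟩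

local instance instHaarUC : Measure.IsAddHaarMeasure (volume : Measure UnitAddCircle) :=
  inferInstanceAs (Measure.IsAddHaarMeasure AddCircle.haarAddCircle)

local instance instProbUC : IsProbabilityMeasure (volume : Measure UnitAddCircle) :=
  inferInstanceAs (IsProbabilityMeasure AddCircle.haarAddCircle)

/-- The covering map. -/
def tq (d : ℕ) (t : Fin d → ℝ) : UnitAddTorus (Fin d) := fun j => (t j : UnitAddCircle)

lemma tq_openQuot (d : ℕ) : IsOpenQuotientMap (tq d) := by
  have : IsOpenQuotientMap (Pi.map (fun (_ : Fin d) (s : ℝ) => (s : UnitAddCircle))) := by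
    apply IsOpenQuotientMap.piMap
    intro i
    exact QuotientAddGroup.isOpenQuotientMap_mk
  exact this

lemma tq_add (d : ℕ) (s t : Fin d → ℝ) : tq d (s + t) = tq d s + tq d t := by
  ext j; simp [tq]

lemma periodic_single {d : ℕ} {h : (Fin d → ℝ) → ℂ} (hp : IsPeriodic d h)
    (y : Fin d → ℝ) (j : Fin d) (z : ℤ) : h (y + Pi.single j (2 * π * z)) = h y := by
  have h1 : Function.Periodic (fun s : ℝ => h (Function.update y j s)) (2 * π) := by
    intro s
    have := hp (Function.update y j s) j
    simpa using this
  have h2 := h1.int_mul z (y j)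
  have h3 : y + Pi.single j (2 * π * z) = Function.update y j (y j + z * (2 * π)) := by
    ext i
    by_cases hi : i = j
    · subst hi; simp; ring
    · simp [hi]
  rw [h3]
  simpa using h2

lemma periodic_all {d : ℕ} {h : (Fin d → ℝ) → ℂ} (hp : IsPeriodic d h)
    (y : Fin d → ℝ) (z : Fin d → ℤ) : h (y + fun j => 2 * π * (z j : ℝ)) = h y := by
  have key : ∀ s : Finset (Fin d), h (y + ∑ j ∈ s, Pi.single j (2 * π * (z j : ℝ))) = h y := by
    intro s
    induction s using Finset.induction_on with
    | empty => simp
    | insert a s ha ih =>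
      rw [Finset.sum_insert ha, add_comm (Pi.single a _), ← add_assoc, periodic_single hp, ih]
  have := key Finset.univ
  rwa [Finset.univ_sum_single] at this

lemma exists_torus {d : ℕ} {h : (Fin d → ℝ) → ℂ} (hc : Continuous h) (hp : IsPeriodic d h) :
    ∃ H : C(UnitAddTorus (Fin d), ℂ), ∀ t : Fin d → ℝ, H (tq d t) = h ((2 * π) • t) := by
  let Q : C(Fin d → ℝ, UnitAddTorus (Fin d)) := ⟨tq d, (tq_openQuot d).continuous⟩
  have hQ : Topology.IsQuotientMap Q := (tq_openQuot d).isQuotientMap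
  let F : C(Fin d → ℝ, ℂ) := ⟨fun t => h ((2 * π) • t), by fun_prop⟩
  have hF : Function.FactorsThrough F Q := by
    intro a b hab
    have hab' : ∀ j, ∃ z : ℤ, b j - a j = z := by
      intro j
      have := congrFun hab j
      simp only [Q, tq, ContinuousMap.coe_mk] at this
      rw [QuotientAddGroup.eq] at this
      obtain ⟨z, hz⟩ := AddSubgroup.mem_zmultiples_iff.1 this
      exact ⟨z, by simp at hz; linarith⟩
    choose z hz using hab'
    change h ((2 * π) • a) = h ((2 * π) • b)
    rw [← periodic_all hp ((2 * π) • a) z]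
    congr 1
    ext j
    simp [← hz j]; ring
  refine ⟨hQ.lift F hF, fun t => ?_⟩
  have := hQ.lift_comp F hF
  exact DFunLike.congr_fun this t

lemma mFourier_tq {d : ℕ} (k : Fin d → ℤ) (t : Fin d → ℝ) :
    UnitAddTorus.mFourier k (tq d t) = _root_.charFun d k ((2 * π) • t) := by
  simp only [UnitAddTorus.mFourier, tq, _root_.charFun, ContinuousMap.coe_mk, fourier_coe_apply]
  rw [← Complex.exp_sum]
  congr 1
  push_cast
  rw [Finset.mul_sum]
  refine Finset.sum_congr rfl fun j _ => ?_
  simp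
  ring

open scoped Pointwise in
lemma coeff_eq {d : ℕ} {h : (Fin d → ℝ) → ℂ} (H : C(UnitAddTorus (Fin d), ℂ))
    (hH : ∀ t : Fin d → ℝ, H (tq d t) = h ((2 * π) • t)) (k : Fin d → ℤ) :
    UnitAddTorus.mFourierCoeff H k = fourierCoeff' d h k := by
  rw [UnitAddTorus.mFourierCoeff_eq_integral H k 0]
  have e : ∀ x : Fin d → ℝ, UnitAddTorus.mFourier (-k) (fun i => (x i : UnitAddCircle)) •
      H (fun i => (x i : UnitAddCircle)) =
      (fun y => h y * (starRingEnd ℂ) (_root_.charFun d k y)) ((2 * π) • x) := by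
    intro x
    have h1 := hH x
    have h2 := mFourier_tq k x
    unfold tq at h1 h2
    rw [UnitAddTorus.mFourier_neg, h1, h2]
    simp [mul_comm]
  simp_rw [e]
  have hpi : (0:ℝ) < 2 * π := by positivity
  rw [Measure.setIntegral_comp_smul_of_pos volume
    (fun y => h y * (starRingEnd ℂ) (_root_.charFun d k y)) _ hpi]
  have hs : (2 * π) • {x : Fin d → ℝ | ∀ i, x i ∈ Set.Ioc ((0 : Fin d → ℝ) i) ((0 : Fin d → ℝ) i + 1)}
      = Set.univ.pi fun _ : Fin d => Set.Ioc (0 : ℝ) (2 * π) := by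
    ext x
    rw [Set.mem_smul_set_iff_inv_smul_mem₀ hpi.ne']
    simp only [Set.mem_ofPred_eq, Set.mem_univ_pi, Set.mem_Ioc, Pi.smul_apply, Pi.zero_apply,
      smul_eq_mul, zero_add]
    refine forall_congr' fun i => and_congr ?_ ?_
    · rw [mul_pos_iff_of_pos_left (by positivity)]
    · rw [inv_mul_le_iff₀ hpi, mul_one]
  rw [hs, fourierCoeff']
  have hae : (Set.univ.pi fun _ : Fin d => Set.Ioc (0 : ℝ) (2 * π)) =ᵐ[volume]
      (Set.univ.pi fun _ : Fin d => Set.Icc (0 : ℝ) (2 * π)) := by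
    have := Measure.univ_pi_Ioc_ae_eq_Icc (μ := fun _ : Fin d => (volume : Measure ℝ))
      (f := fun _ => (0:ℝ)) (g := fun _ => 2 * π)
    rw [Set.pi_univ_Icc]
    exact this
  rw [setIntegral_congr_set hae]
  simp

lemma deriv_coeff {d : ℕ} {h h' : (Fin d → ℝ) → ℂ} (hc : Continuous h) (hp : IsPeriodic d h)
    (hc' : Continuous h') (hp' : IsPeriodic d h') (j : Fin d)
    (hd : ∀ y, HasDerivAt (fun s : ℝ => h (y + s • Pi.single j (1:ℝ))) (h' y) 0)
    (k : Fin d → ℤ) :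
    fourierCoeff' d h' k = Complex.I * k j * fourierCoeff' d h k := by
  obtain ⟨H, hH⟩ := exists_torus hc hp
  obtain ⟨H', hH'⟩ := exists_torus hc' hp'
  rw [← coeff_eq H hH, ← coeff_eq H' hH']
  let e : ℝ → UnitAddTorus (Fin d) := fun s => tq d (s • Pi.single j (1:ℝ))
  have he : Continuous e := (tq_openQuot d).continuous.comp (by fun_prop)
  let φ : ℝ → ℂ := fun s => ∫ x, UnitAddTorus.mFourier (-k) x * H (x + e s)
  have hφ1 : ∀ s, φ s = Complex.exp (2 * π * Complex.I * k j * s) * UnitAddTorus.mFourierCoeff H k := by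
    intro s
    have h1 : φ s = ∫ x, UnitAddTorus.mFourier (-k) (x - e s) * H x := by
      rw [← integral_add_right_eq_self (μ := volume) _ (e s)]
      simp [φ]
    rw [h1, UnitAddTorus.mFourierCoeff, ← integral_const_mul]
    congr 1
    ext x
    have h2 : UnitAddTorus.mFourier (-k) (x - e s) =
       UnitAddTorus.mFourier (-k) x * UnitAddTorus.mFourier k (e s) := by
      obtain ⟨y, rfl⟩ := (tq_openQuot d).surjective x
      have : tq d y - e s = tq d (y - s • Pi.single j 1) := by
        rw [sub_eq_iff_eq_add, ← tq_add]; simp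
      rw [this, mFourier_tq, mFourier_tq, mFourier_tq, _root_.charFun, _root_.charFun, _root_.charFun, ← Complex.exp_add,
        ← mul_add, ← Complex.ofReal_add, ← Finset.sum_add_distrib]
      congr 3
      refine Finset.sum_congr rfl fun i _ => ?_
      simp; ring
    have h3 : UnitAddTorus.mFourier k (e s) = Complex.exp (2 * π * Complex.I * k j * s) := by
      rw [mFourier_tq, _root_.charFun]
      congr 1
      have : ∑ i, (k i : ℝ) * ((2 * π) • s • (Pi.single j (1:ℝ) : Fin d → ℝ)) i = k j * (2 * π * s) := by
        rw [Finset.sum_eq_single j]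
        · simp
        · intro b _ hb; simp [hb]
        · simp
      rw [this]; push_cast; ring
    rw [h2, h3, smul_eq_mul]; ring
  have hφd1 : HasDerivAt φ (2 * π * Complex.I * k j * UnitAddTorus.mFourierCoeff H k) 0 := by
    have : φ = fun s : ℝ => Complex.exp (2 * π * Complex.I * k j * s) * UnitAddTorus.mFourierCoeff H k :=
      funext hφ1
    rw [this]
    have h1 : HasDerivAt (fun s : ℝ => (2 * π * Complex.I * k j * s : ℂ)) (2 * π * Complex.I * k j) 0 := by
      simpa using (Complex.ofRealCLM.hasDerivAt (x := (0:ℝ))).const_mul (2 * π * Complex.I * k j)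
    have := (h1.cexp).mul_const (UnitAddTorus.mFourierCoeff H k)
    simpa using this
  have hder : ∀ x s, HasDerivAt (fun s => H (x + e s)) (2 * π * H' (x + e s)) s := by
    intro x s
    obtain ⟨y, rfl⟩ := (tq_openQuot d).surjective x
    have e1 : ∀ s, tq d y + e s = tq d (y + s • Pi.single j 1) := fun s => (tq_add _ _ _).symm
    simp_rw [e1, hH, hH']
    have h0 := hd ((2 * π) • (y + s • Pi.single j 1))
    have h1 : HasDerivAt (fun r : ℝ => 2 * π * (r - s)) (2 * π) s := by
      simpa using ((hasDerivAt_id s).sub_const s).const_mul (2 * π)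
    have h0' : HasDerivAt (fun r : ℝ => h ((2 * π) • (y + s • Pi.single j 1) + r • Pi.single j (1:ℝ)))
        (h' ((2 * π) • (y + s • Pi.single j 1))) ((fun r : ℝ => 2 * π * (r - s)) s) := by
      simpa using h0
    have h2 := HasDerivAt.scomp s h0' h1
    convert! h2 using 1
    · ext r
      simp only [Function.comp]
      congr 1
      ext i
      simp; ring
    · simp
  have hφd2 : HasDerivAt φ (∫ x, UnitAddTorus.mFourier (-k) x * (2 * π * H' (x + e 0))) 0 := by
    refine (hasDerivAt_integral_of_dominated_loc_of_deriv_le (s := Set.univ) (μ := volume)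
      (F := fun s x => UnitAddTorus.mFourier (-k) x * H (x + e s))
      (F' := fun s x => UnitAddTorus.mFourier (-k) x * (2 * π * H' (x + e s)))
      (bound := fun _ => 2 * π * ‖H'‖) Filter.univ_mem ?_ ?_ ?_ ?_ ?_ ?_).2
    · exact Filter.Eventually.of_forall fun s => Continuous.aestronglyMeasurable (by fun_prop)
    · exact Continuous.integrable_of_hasCompactSupport (by fun_prop) (HasCompactSupport.of_compactSpace _)
    · exact Continuous.aestronglyMeasurable (by fun_prop)
    · refine Filter.Eventually.of_forall fun x s _ => ?_
      have h1 := H'.norm_coe_le_norm (x + e s)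
      have h2 := (UnitAddTorus.mFourier (-k)).norm_coe_le_norm x
      rw [UnitAddTorus.mFourier_norm] at h2
      rw [norm_mul, norm_mul]
      have h3 : ‖(2 * π : ℂ)‖ = 2 * π := by
        simp [abs_of_pos Real.pi_pos]
      rw [h3]
      calc _ ≤ 1 * (2 * π * ‖H'‖) := by gcongr
        _ = _ := one_mul _
    · exact integrable_const _
    · refine Filter.Eventually.of_forall fun x s _ => ?_
      exact (hder x s).const_mul _
  have h4 := hφd1.unique hφd2
  have h5 : ∫ x, UnitAddTorus.mFourier (-k) x * (2 * π * H' (x + e 0)) =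
      2 * π * UnitAddTorus.mFourierCoeff H' k := by
    rw [UnitAddTorus.mFourierCoeff, ← integral_const_mul]
    congr 1
    ext x
    have : x + e 0 = x := by
      ext i; simp [e, tq]
    rw [this, smul_eq_mul]; ring
  rw [h5] at h4
  have hpi : (2 * π : ℂ) ≠ 0 := by simp [Real.pi_ne_zero]
  apply mul_left_cancel₀ hpi
  rw [← h4]; ring

lemma parseval_le {d : ℕ} {h : (Fin d → ℝ) → ℂ} (hc : Continuous h) (hp : IsPeriodic d h)
    {M : ℝ} (hM : ∀ y, ‖h y‖ ≤ M) :
    Summable (fun k => ‖fourierCoeff' d h k‖ ^ 2) ∧ ∑' k, ‖fourierCoeff' d h k‖ ^ 2 ≤ M ^ 2 := by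
  obtain ⟨H, hH⟩ := exists_torus hc hp
  have h1 := UnitAddTorus.hasSum_sq_mFourierCoeff (H.toLp 2 volume ℂ)
  simp_rw [UnitAddTorus.mFourierCoeff_toLp, coeff_eq H hH] at h1
  refine ⟨h1.summable, ?_⟩
  rw [h1.tsum_eq]
  have h2 : ∀ᵐ t ∂(volume : Measure (UnitAddTorus (Fin d))), ‖(H.toLp 2 volume ℂ) t‖ ^ 2 ≤ M ^ 2 := by
    filter_upwards [ContinuousMap.coeFn_toLp (p := 2) (𝕜 := ℂ) volume H] with t ht
    rw [ht]
    obtain ⟨y, rfl⟩ := (tq_openQuot d).surjective t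
    rw [hH]
    gcongr
    exact hM _
  calc _ ≤ ∫ t : UnitAddTorus (Fin d), M ^ 2 := by
        apply integral_mono_of_nonneg
        · exact Filter.Eventually.of_forall fun _ => by positivity
        · exact integrable_const _
        · exact h2
    _ = M ^ 2 := by simp

lemma series_hasSum {d : ℕ} {h : (Fin d → ℝ) → ℂ} (hc : Continuous h) (hp : IsPeriodic d h)
    (hs : Summable (fourierCoeff' d h)) (y : Fin d → ℝ) :
    HasSum (fun k => fourierCoeff' d h k * _root_.charFun d k y) (h y) := by
  obtain ⟨H, hH⟩ := exists_torus hc hp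
  have e : UnitAddTorus.mFourierCoeff H = fourierCoeff' d h := funext (coeff_eq H hH)
  have := UnitAddTorus.hasSum_mFourier_series_apply_of_summable (f := H) (e ▸ hs)
    (tq d ((2 * π)⁻¹ • y))
  have hpi : (2 * π : ℝ) ≠ 0 := by positivity
  simp_rw [coeff_eq H hH, mFourier_tq, hH, smul_inv_smul₀ hpi] at this
  exact this

lemma iter_coeff {d m : ℕ} {g : (Fin d → ℝ) → ℂ} {M : ℝ} (hg : ContDiff ℝ (2 * m + 1) g)
    (hp : IsPeriodic d g) (hM : ∀ i ≤ 2 * m + 1, ∀ y, ‖iteratedFDeriv ℝ i g y‖ ≤ M)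
    (j : Fin d) :
    Summable (fun k : Fin d → ℤ => ((k j : ℝ) ^ 2) ^ (2 * m) * ‖fourierCoeff' d g k‖ ^ 2) ∧
    ∑' k : Fin d → ℤ, ((k j : ℝ) ^ 2) ^ (2 * m) * ‖fourierCoeff' d g k‖ ^ 2 ≤ M ^ 2 := by
  let h : ℕ → (Fin d → ℝ) → ℂ := fun i y => iteratedFDeriv ℝ i g y (fun _ => Pi.single j 1)
  have hdiff : ∀ i ≤ 2 * m, Differentiable ℝ (iteratedFDeriv ℝ i g) := by
    intro i hi
    apply hg.differentiable_iteratedFDeriv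
    have : i < 2 * m + 1 := by omega
    exact_mod_cast this
  have hc : ∀ i ≤ 2 * m, Continuous (h i) := by
    intro i hi
    have := (hdiff i hi).continuous
    fun_prop
  have hper : ∀ i, IsPeriodic d (h i) := by
    intro i y l
    have e1 : ∀ z : Fin d → ℝ, Function.update z l (z l + 2 * π) = z + Pi.single l (2 * π) := by
      intro z; ext r
      by_cases hr : r = l
      · subst hr; simp
      · simp [hr]
    have e2 : (fun z => g (z + Pi.single l (2 * π))) = g := by
      ext z; rw [← e1]; exact hp z l
    have e3 := iteratedFDeriv_comp_add_right (𝕜 := ℝ) (f := g) i (Pi.single l (2 * π)) y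
    rw [e2] at e3
    simp only [h]
    rw [e1, e3]
  have hder : ∀ i < 2 * m, ∀ y, HasDerivAt (fun s : ℝ => h i (y + s • Pi.single j (1:ℝ))) (h (i+1) y) 0 := by
    intro i hi y
    have h1 := (hdiff i hi.le y).hasFDerivAt
    have h2 : HasDerivAt (fun s : ℝ => y + s • (Pi.single j (1:ℝ) : Fin d → ℝ)) (Pi.single j (1:ℝ)) 0 := by
      simpa using ((hasDerivAt_id (0:ℝ)).smul_const (Pi.single j (1:ℝ) : Fin d → ℝ)).const_add y
    have h1' : HasFDerivAt (iteratedFDeriv ℝ i g) (fderiv ℝ (iteratedFDeriv ℝ i g) y)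
        ((fun s : ℝ => y + s • (Pi.single j (1:ℝ) : Fin d → ℝ)) 0) := by simpa using h1
    have h3 := h1'.comp_hasDerivAt (0:ℝ) h2
    have h4 := ((ContinuousMultilinearMap.apply ℝ (fun _ : Fin i => Fin d → ℝ) ℂ
      (fun _ => Pi.single j 1)).hasFDerivAt).comp_hasDerivAt (0:ℝ) h3
    exact h4
  have hco : ∀ i ≤ 2 * m, ∀ k, fourierCoeff' d (h i) k = (Complex.I * k j) ^ i * fourierCoeff' d g k := by
    intro i
    induction i with
    | zero =>
      intro _ k
      have : h 0 = g := by ext y; simp [h]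
      simp [this]
    | succ i ih =>
      intro hi k
      rw [deriv_coeff (hc i (by omega)) (hper i) (hc (i+1) hi) (hper (i+1)) j (hder i (by omega)) k,
        ih (by omega)]
      ring
  have hbd : ∀ y, ‖h (2 * m) y‖ ≤ M := by
    intro y
    have h1 := (iteratedFDeriv ℝ (2 * m) g y).le_opNorm (fun _ => Pi.single j 1)
    have h2 : ‖(Pi.single j 1 : Fin d → ℝ)‖ = 1 := by simp [Pi.norm_single]
    simp only [h2, Finset.prod_const_one, mul_one] at h1
    exact h1.trans (hM _ (by omega) y)
  have key := parseval_le (hc _ le_rfl) (hper _) hbd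
  have e : ∀ k, ‖fourierCoeff' d (h (2 * m)) k‖ ^ 2 =
      ((k j : ℝ) ^ 2) ^ (2 * m) * ‖fourierCoeff' d g k‖ ^ 2 := by
    intro k
    rw [hco _ le_rfl, norm_mul, norm_pow, norm_mul, Complex.norm_I, one_mul, Complex.norm_intCast,
      mul_pow, ← pow_mul, mul_comm (2 * m) 2, pow_mul, sq_abs]
  simp_rw [e] at key
  exact key

lemma latNormSq_nonneg (d : ℕ) (k : Fin d → ℤ) : 0 ≤ latNormSq d k :=
  Finset.sum_nonneg fun _ _ => sq_nonneg _

lemma sq_le_latNormSq {d : ℕ} (k : Fin d → ℤ) (j : Fin d) : (k j : ℝ) ^ 2 ≤ latNormSq d k :=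
  Finset.single_le_sum (f := fun j => (k j : ℝ) ^ 2) (fun _ _ => sq_nonneg _) (Finset.mem_univ j)

lemma weight_le (d p : ℕ) (k : Fin d → ℤ) :
    (1 + latNormSq d k) ^ (p + 1) ≤ (d + 1 : ℝ) ^ p * (1 + ∑ j, ((k j : ℝ) ^ 2) ^ (p + 1)) := by
  have := pow_sum_div_card_le_sum_pow (s := (Finset.univ : Finset (Option (Fin d))))
    (f := fun o => o.elim (1:ℝ) (fun j => (k j : ℝ) ^ 2))
    (by rintro (_ | j) _ <;> simp; positivity) p
  rw [Fintype.sum_option, Fintype.sum_option] at this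
  rw [div_le_iff₀ (by simp; positivity)] at this
  simp only [Option.elim, one_pow] at this
  rw [latNormSq, mul_comm]
  simpa using this

lemma sobolev_bound {d m : ℕ} (hm : 0 < m) {g : (Fin d → ℝ) → ℂ} {M : ℝ}
    (hg : ContDiff ℝ (2 * m + 1) g)
    (hp : IsPeriodic d g) (hM : ∀ i ≤ 2 * m + 1, ∀ y, ‖iteratedFDeriv ℝ i g y‖ ≤ M) :
    Summable (fun k : Fin d → ℤ => (1 + latNormSq d k) ^ (2 * m) * ‖fourierCoeff' d g k‖ ^ 2) ∧
    ∑' k : Fin d → ℤ, (1 + latNormSq d k) ^ (2 * m) * ‖fourierCoeff' d g k‖ ^ 2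
      ≤ (d + 1 : ℝ) ^ (2 * m) * M ^ 2 := by
  have h0 : ∀ y, ‖g y‖ ≤ M := by
    intro y
    have := hM 0 (by omega) y
    rwa [norm_iteratedFDeriv_zero] at this
  obtain ⟨s0, b0⟩ := parseval_le hg.continuous hp h0
  have hj := fun j => iter_coeff hg hp hM j
  obtain ⟨q, hq⟩ : ∃ q, 2 * m = q + 1 := ⟨2 * m - 1, by omega⟩
  rw [hq] at hj ⊢
  have S := (s0.hasSum.add (hasSum_sum (s := Finset.univ) fun j _ => (hj j).1.hasSum)).mul_left
    ((d + 1 : ℝ) ^ q)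
  have hle : ∀ k : Fin d → ℤ, (1 + latNormSq d k) ^ (q + 1) * ‖fourierCoeff' d g k‖ ^ 2 ≤
      (d + 1 : ℝ) ^ q * (‖fourierCoeff' d g k‖ ^ 2 +
        ∑ j, ((k j : ℝ) ^ 2) ^ (q + 1) * ‖fourierCoeff' d g k‖ ^ 2) := by
    intro k
    have := mul_le_mul_of_nonneg_right (weight_le d q k) (sq_nonneg ‖fourierCoeff' d g k‖)
    rw [← Finset.sum_mul]
    refine this.trans (le_of_eq ?_)
    ring
  have hnn : ∀ k : Fin d → ℤ, 0 ≤ (1 + latNormSq d k) ^ (q + 1) * ‖fourierCoeff' d g k‖ ^ 2 := by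
    intro k
    have := latNormSq_nonneg d k
    positivity
  have hsum := Summable.of_nonneg_of_le hnn hle S.summable
  refine ⟨hsum, ?_⟩
  refine (hsum.tsum_le_tsum hle S.summable).trans ?_
  rw [S.tsum_eq, pow_succ, mul_assoc]
  gcongr
  calc _ ≤ M ^ 2 + ∑ j : Fin d, M ^ 2 := by
        gcongr with j _
        exact (hj j).2
    _ = _ := by simp; ring

lemma summable_one_dim {a : ℝ} (ha : 1 / 2 < a) :
    Summable (fun z : ℤ => ((1 + (z : ℝ) ^ 2) ^ a)⁻¹) := by
  have h1 : Summable (fun z : ℤ => |(z : ℝ)| ^ (-(2 * a))) :=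
    Real.summable_abs_int_rpow (by linarith)
  have h2 : Summable (fun z : ℤ => if z = 0 then (1:ℝ) else 0) := (hasSum_ite_eq 0 1).summable
  refine Summable.of_nonneg_of_le (fun z => by positivity) (fun z => ?_) (h1.add h2)
  by_cases hz : z = 0
  · subst hz
    simp only [Int.cast_zero, if_true]
    norm_num
    positivity
  · have hz' : 0 < |(z : ℝ)| := by positivity
    simp only [hz, if_false, add_zero]
    rw [Real.rpow_neg hz'.le, Real.rpow_mul hz'.le]
    gcongr
    rw [Real.rpow_two, sq_abs]
    linarith

lemma summable_lattice {d p : ℕ} (hp : (d : ℝ) / 2 < p) :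
    Summable (fun k : Fin d → ℤ => ((1 + latNormSq d k) ^ p)⁻¹) := by
  rcases Nat.eq_zero_or_pos d with rfl | hd
  · exact Summable.of_finite
  have hd' : (0:ℝ) < d := by exact_mod_cast hd
  have S := summable_one_dim (a := p / d) (by rw [lt_div_iff₀ hd']; linarith)
  set f : ℤ → ℝ := fun z => ((1 + (z : ℝ) ^ 2) ^ ((p : ℝ) / d))⁻¹ with hf
  have hf0 : ∀ z, 0 ≤ f z := fun z => by positivity
  have hle : ∀ k : Fin d → ℤ, ((1 + latNormSq d k) ^ p)⁻¹ ≤ ∏ j, f (k j) := by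
    intro k
    have hk := latNormSq_nonneg d k
    simp only [hf]
    rw [Finset.prod_inv_distrib]
    refine inv_anti₀ (Finset.prod_pos fun j _ => by positivity) ?_
    calc ∏ j, (1 + (k j : ℝ) ^ 2) ^ ((p : ℝ) / d) ≤ ∏ j : Fin d, (1 + latNormSq d k) ^ ((p : ℝ) / d) := by
          gcongr with j _
          exact sq_le_latNormSq k j
      _ = _ := by
          rw [Finset.prod_const, Finset.card_univ, Fintype.card_fin, ← Real.rpow_natCast,
            ← Real.rpow_mul (by positivity), div_mul_cancel₀ _ hd'.ne', Real.rpow_natCast]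
  refine Summable.of_nonneg_of_le (fun k => by have := latNormSq_nonneg d k; positivity) hle ?_
  refine summable_of_sum_le (c := (∑' z, f z) ^ d) (fun k => Finset.prod_nonneg fun j _ => hf0 _) ?_
  intro u
  classical
  let t : Fin d → Finset ℤ := fun j => u.image (fun k => k j)
  calc ∑ k ∈ u, ∏ j, f (k j) ≤ ∑ k ∈ Fintype.piFinset t, ∏ j, f (k j) := by
        apply Finset.sum_le_sum_of_subset_of_nonneg
        · intro k hk
          rw [Fintype.mem_piFinset]
          intro j
          exact Finset.mem_image_of_mem _ hk
        · intro k _ _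
          exact Finset.prod_nonneg fun j _ => hf0 _
    _ = ∏ j, ∑ z ∈ t j, f z := (Finset.prod_univ_sum t (fun _ z => f z)).symm
    _ ≤ ∏ j : Fin d, ∑' z, f z := by
        gcongr with j _
        exact S.sum_le_tsum _ fun z _ => hf0 z
    _ = _ := by simp

lemma char_orth {d n : ℕ} (p k : Fin d → ℤ) :
    dInner d n (fun x => _root_.charFun d p (discPt d n x)) (fun x => _root_.charFun d k (discPt d n x)) =
      if ∀ j, ((2 * n + 1 : ℕ) : ℤ) ∣ p j - k j then 1 else 0 := by
  have e : ∀ x : DTorus d n, _root_.charFun d p (discPt d n x) *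
      (starRingEnd ℂ) (_root_.charFun d k (discPt d n x)) =
      ∏ j, ZMod.stdAddChar (x j * ((p j - k j : ℤ) : ZMod (2 * n + 1))) := by
    intro x
    have e1 : ∀ j, x j * ((p j - k j : ℤ) : ZMod (2 * n + 1)) =
        (((x j).val * (p j - k j) : ℤ) : ZMod (2 * n + 1)) := by
      intro j; push_cast; simp
    simp_rw [e1, ZMod.stdAddChar_coe]
    rw [← Complex.exp_sum, _root_.charFun, _root_.charFun, ← Complex.exp_conj, ← Complex.exp_add]
    congr 1
    simp only [map_mul, Complex.conj_I, Complex.conj_ofReal]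
    push_cast
    rw [neg_mul, ← sub_eq_add_neg, ← mul_sub, ← Finset.sum_sub_distrib, Finset.mul_sum]
    refine Finset.sum_congr rfl fun j _ => ?_
    simp only [discPt]
    push_cast
    ring
  rw [dInner]
  simp_rw [e]
  have e2 := (Finset.prod_univ_sum (fun _ : Fin d => (Finset.univ : Finset (ZMod (2 * n + 1))))
    (fun j z => ZMod.stdAddChar (z * ((p j - k j : ℤ) : ZMod (2 * n + 1)))))
  rw [Fintype.piFinset_univ] at e2
  rw [← e2]
  simp_rw [AddChar.sum_mulShift _ (ZMod.isPrimitive_stdAddChar (2 * n + 1)), ZMod.card,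
    ZMod.intCast_zmod_eq_zero_iff_dvd]
  split_ifs with h
  · simp only [h, if_true]
    rw [Finset.prod_const, Finset.card_univ, Fintype.card_fin]
    push_cast
    apply inv_mul_cancel₀
    have : (2 * n + 1 : ℂ) ≠ 0 := by exact_mod_cast (by omega : 2 * n + 1 ≠ 0)
    positivity
  · push Not at h
    obtain ⟨j, hj⟩ := h
    rw [Finset.prod_eq_zero (Finset.mem_univ j)]
    · simp
    · simp only [hj, if_false]; simp

/-- Wrap-around condition. -/
def WrapCond (d n : ℕ) (k p : Fin d → ℤ) : Prop :=
  (∀ j, ((2 * n + 1 : ℕ) : ℤ) ∣ p j - k j) ∧ p ≠ k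

open Classical in
lemma wrap_hasSum {d n : ℕ} {g : (Fin d → ℝ) → ℂ} (hc : Continuous g) (hp : IsPeriodic d g)
    (hs : Summable (fourierCoeff' d g)) (k : Fin d → ℤ) (hk : ∀ j, |k j| ≤ (n : ℤ)) :
    HasSum (fun p => if WrapCond d n k p then fourierCoeff' d g p else 0)
      (exCoef d n (fun x => g (discPt d n x)) k - fourierCoeff' d g k) := by
  have h1 : HasSum (fun p => fourierCoeff' d g p *
      dInner d n (fun x => _root_.charFun d p (discPt d n x))
        (fun x => _root_.charFun d k (discPt d n x)))
      (exCoef d n (fun x => g (discPt d n x)) k) := by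
    rw [exCoef, if_pos hk, dInner]
    have := (hasSum_sum (s := (Finset.univ : Finset (DTorus d n))) fun x _ =>
      (series_hasSum hc hp hs (discPt d n x)).mul_right
        ((starRingEnd ℂ) (_root_.charFun d k (discPt d n x)))).mul_left
        ((((2 * (n : ℝ) + 1) ^ d : ℝ) : ℂ)⁻¹)
    convert! this using 1
    ext p
    rw [dInner, Finset.mul_sum, Finset.mul_sum, Finset.mul_sum]
    refine Finset.sum_congr rfl fun x _ => ?_
    ring
  have h2 : HasSum (fun p => if p = k then fourierCoeff' d g k else 0) (fourierCoeff' d g k) :=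
    hasSum_ite_eq k _
  convert! h1.sub h2 using 1
  ext p
  rw [char_orth]
  by_cases hpk : p = k
  · subst hpk; simp [WrapCond]
  · simp [WrapCond, hpk]

lemma wrap_weight {d n : ℕ} (k l : Fin d → ℤ) (hk : ∀ j, |k j| ≤ (n : ℤ)) (hl : l ≠ 0) :
    (n : ℝ) ^ 2 * (1 + latNormSq d l) ≤ 2 * (1 + latNormSq d (fun j => k j + (2 * n + 1 : ℕ) * l j)) := by
  have h1 : (n : ℝ) ^ 2 * latNormSq d l ≤ latNormSq d (fun j => k j + (2 * n + 1 : ℕ) * l j) := by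
    rw [latNormSq, latNormSq, Finset.mul_sum]
    refine Finset.sum_le_sum fun j _ => ?_
    rw [← mul_pow, sq_le_sq]
    have : |(n : ℤ) * l j| ≤ |k j + (2 * n + 1 : ℕ) * l j| := by
      by_cases h0 : l j = 0
      · simp [h0]
      · have a1 : 1 ≤ |l j| := Int.one_le_abs h0
        have a2 := hk j
        have a3 : |((2 * n + 1 : ℕ) : ℤ) * l j| ≤ |k j + (2 * n + 1 : ℕ) * l j| + |k j| := by
          calc _ = |(k j + (2 * n + 1 : ℕ) * l j) - k j| := by ring_nf
            _ ≤ _ := abs_sub _ _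
        rw [abs_mul, Nat.abs_cast] at a3 ⊢
        push_cast at a3 ⊢
        have hn : (0 : ℤ) ≤ n := by positivity
        nlinarith
    exact_mod_cast this
  have h2 : 1 ≤ latNormSq d l := by
    obtain ⟨j, hj⟩ := Function.ne_iff.1 hl
    have a1 : 1 ≤ |l j| := Int.one_le_abs hj
    have a2 : (1:ℝ) ≤ |(l j : ℝ)| := by exact_mod_cast a1
    calc (1:ℝ) ≤ (l j : ℝ) ^ 2 := by rw [← sq_abs]; nlinarith
      _ ≤ _ := sq_le_latNormSq l j
  have hn : (0:ℝ) ≤ (n:ℝ) ^ 2 := by positivity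
  nlinarith

open Classical in
lemma wrap_sum_le {d n q : ℕ} (hn : 1 ≤ n)
    (hA : Summable (fun k : Fin d → ℤ => ((1 + latNormSq d k) ^ q)⁻¹))
    (k : Fin d → ℤ) (hk : ∀ j, |k j| ≤ (n : ℤ)) (F : Finset (Fin d → ℤ)) :
    ∑ p ∈ F, (if WrapCond d n k p then ((1 + latNormSq d p) ^ q)⁻¹ else 0) ≤
      2 ^ q * (((n : ℝ) ^ 2) ^ q)⁻¹ * ∑' l : Fin d → ℤ, ((1 + latNormSq d l) ^ q)⁻¹ := by
  have hpos : ∀ p : Fin d → ℤ, 0 < 1 + latNormSq d p := fun p => by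
    have := latNormSq_nonneg d p; positivity
  set u : (Fin d → ℤ) → ℝ := fun p => if WrapCond d n k p then ((1 + latNormSq d p) ^ q)⁻¹ else 0
    with hu
  have hu0 : ∀ p, 0 ≤ u p := by
    intro p; have := hpos p; simp only [hu]; split_ifs <;> positivity
  have hu1 : ∀ p, u p ≤ ((1 + latNormSq d p) ^ q)⁻¹ := by
    intro p; have := hpos p; simp only [hu]; split_ifs
    · exact le_rfl
    · positivity
  have hus : Summable u := Summable.of_nonneg_of_le hu0 hu1 hA
  let ι : (Fin d → ℤ) → (Fin d → ℤ) := fun l j => k j + (2 * n + 1 : ℕ) * l j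
  have hN : ((2 * n + 1 : ℕ) : ℤ) ≠ 0 := by omega
  have hι : Function.Injective ι := by
    intro a b hab
    ext j
    have := congrFun hab j
    simp only [ι] at this
    exact mul_left_cancel₀ hN (add_left_cancel this)
  have hsupp : Function.support u ⊆ Set.range ι := by
    intro p hp
    have hcond : WrapCond d n k p := by
      by_contra h
      exact hp (by simp [hu, h])
    choose l hl using hcond.1
    refine ⟨l, ?_⟩
    ext j
    simp only [ι]
    rw [← hl j]; ring
  have hn' : (0:ℝ) < n := by exact_mod_cast hn
  calc ∑ p ∈ F, u p ≤ ∑' p, u p := hus.sum_le_tsum _ fun p _ => hu0 p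
    _ = ∑' l, u (ι l) := (hι.tsum_eq hsupp).symm
    _ ≤ ∑' l, 2 ^ q * (((n : ℝ) ^ 2) ^ q)⁻¹ * ((1 + latNormSq d l) ^ q)⁻¹ := by
        refine Summable.tsum_le_tsum (fun l => ?_) (hus.comp_injective hι) (hA.mul_left _)
        have hl0 := hpos l
        by_cases hc : WrapCond d n k (ι l)
        · have hl : l ≠ 0 := by
            rintro rfl
            apply hc.2
            ext j; simp [ι]
          simp only [hu, hc, if_true]
          have h1 := wrap_weight (n := n) k l hk hl
          have h2 := hpos (ι l)
          have h3 : ((n:ℝ) ^ 2 * (1 + latNormSq d l)) ^ q ≤ (2 * (1 + latNormSq d (ι l))) ^ q :=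
            pow_le_pow_left₀ (by positivity) h1 q
          rw [mul_pow, mul_pow] at h3
          rw [mul_assoc, ← mul_inv, ← div_eq_mul_inv, inv_eq_one_div, div_le_div_iff₀ (by positivity)
            (by positivity), one_mul]
          exact h3
        · simp only [hu, hc, if_false]
          positivity
    _ = _ := tsum_mul_left

open Classical in
lemma wrap_err {d n q : ℕ} (hn : 1 ≤ n) {g : (Fin d → ℝ) → ℂ} (hc : Continuous g)
    (hp : IsPeriodic d g)
    (hA : Summable (fun k : Fin d → ℤ => ((1 + latNormSq d k) ^ q)⁻¹))
    (hS : Summable (fun k : Fin d → ℤ => (1 + latNormSq d k) ^ q * ‖fourierCoeff' d g k‖ ^ 2))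
    (k : Fin d → ℤ) (hk : ∀ j, |k j| ≤ (n : ℤ)) :
    ‖exCoef d n (fun x => g (discPt d n x)) k - fourierCoeff' d g k‖ ^ 2 ≤
      (2 ^ q * (((n : ℝ) ^ 2) ^ q)⁻¹ * ∑' l : Fin d → ℤ, ((1 + latNormSq d l) ^ q)⁻¹) *
      ∑' k : Fin d → ℤ, (1 + latNormSq d k) ^ q * ‖fourierCoeff' d g k‖ ^ 2 := by
  have hpos : ∀ p : Fin d → ℤ, 0 < 1 + latNormSq d p := fun p => by
    have := latNormSq_nonneg d p; positivity
  have hs : Summable (fourierCoeff' d g) := by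
    refine Summable.of_norm_bounded (hA.add hS) fun p => ?_
    have hw : 0 < (1 + latNormSq d p) ^ q := pow_pos (hpos p) q
    set w := (1 + latNormSq d p) ^ q
    set c := ‖fourierCoeff' d g p‖
    have hc0 : 0 ≤ c := norm_nonneg _
    have : w⁻¹ + w * c ^ 2 - c = w⁻¹ * ((w * c - 1 / 2) ^ 2 + 3 / 4) := by
      field_simp; ring
    have h2 : 0 ≤ w⁻¹ * ((w * c - 1 / 2) ^ 2 + 3 / 4) := by positivity
    linarith
  have H := wrap_hasSum (n := n) hc hp hs k hk
  have hlim := (H.norm).pow 2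
  refine le_of_tendsto hlim (Filter.Eventually.of_forall fun F => ?_)
  calc _ ≤ (∑ p ∈ F, ‖if WrapCond d n k p then fourierCoeff' d g p else 0‖) ^ 2 := by
        gcongr; exact norm_sum_le _ _
    _ ≤ (∑ p ∈ F, (if WrapCond d n k p then ((1 + latNormSq d p) ^ q)⁻¹ else 0)) *
        ∑ p ∈ F, (1 + latNormSq d p) ^ q * ‖fourierCoeff' d g p‖ ^ 2 := by
        apply Finset.sum_sq_le_sum_mul_sum_of_sq_eq_mul
        · intro p _; have := hpos p; split_ifs <;> positivity
        · intro p _; have := hpos p; positivity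
        · intro p _
          have := pow_pos (hpos p) q
          split_ifs
          · field_simp
          · simp
    _ ≤ _ := by
        gcongr
        · exact Finset.sum_nonneg fun p _ => by have := hpos p; positivity
        · exact mul_nonneg (by positivity) (tsum_nonneg fun p => by have := hpos p; positivity)
        · exact wrap_sum_le hn hA k hk F
        · exact hS.sum_le_tsum _ fun p _ => by have := hpos p; positivity

lemma mem_cube_iff {d n : ℕ} (k : Fin d → ℤ) : k ∈ cube d n ↔ ∀ j, |k j| ≤ (n : ℤ) := by
  simp [cube, Fintype.mem_piFinset, abs_le]

lemma cube_card_le {d n : ℕ} (hn : 1 ≤ n) : ((cube d n).card : ℝ) ≤ 3 ^ d * (n : ℝ) ^ d := by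
  have h1 : (cube d n).card = (2 * n + 1) ^ d := by
    rw [cube, Fintype.card_piFinset]
    simp only [Int.card_Icc, Finset.prod_const, Finset.card_univ, Fintype.card_fin]
    congr 1
    omega
  rw [h1, ← mul_pow]
  push_cast
  have : (1:ℝ) ≤ n := by exact_mod_cast hn
  gcongr
  linarith

/-- Let `J ≥ 0` and `m ∈ ℕ` with `2m > J + 1 + d/2`.  Then there is a constant
`C_{J,m}` such that for each `f ∈ C^{2m+1}(T^d)` (with `C^{2m+1}`-norm bounded by `M`)
and all `n ≥ 1`, `‖ex_n f - f‖_{H_J} ≤ (C_{J,m}/n) ‖f‖_{C^{2m+1}}`: trigonometric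
interpolation on the grid with `(2n+1)^d` points approximates smooth functions at rate
`1/n` in `H_J`. -/
theorem trigonometric_interpolation_error (d : ℕ) (J : ℝ) (m : ℕ)
    (hJ : 0 ≤ J) (hm : J + 1 + (d : ℝ) / 2 < 2 * (m : ℝ)) :
    ∃ C > 0, ∀ (g : (Fin d → ℝ) → ℂ) (M : ℝ),
      ContDiff ℝ (2 * m + 1) g → IsPeriodic d g →
      (∀ i ≤ 2 * m + 1, ∀ y, ‖iteratedFDeriv ℝ i g y‖ ≤ M) →
      ∀ n : ℕ, 1 ≤ n →
        sobNorm d J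
            (fun k => exCoef d n (fun x => g (discPt d n x)) k - fourierCoeff' d g k)
          ≤ C / n * M := by
  have hd0 : (0:ℝ) ≤ d := by positivity
  have hm0 : 0 < m := by
    rcases Nat.eq_zero_or_pos m with h | h
    · subst h; simp at hm; linarith
    · exact h
  have hA := summable_lattice (d := d) (p := 2 * m) (by push_cast; linarith)
  set A := ∑' l : Fin d → ℤ, ((1 + latNormSq d l) ^ (2 * m))⁻¹ with hAdef
  have hpos : ∀ p : Fin d → ℤ, 0 < 1 + latNormSq d p := fun p => by
    have := latNormSq_nonneg d p; positivity
  have hA0 : 0 ≤ A := tsum_nonneg fun p => by have := hpos p; positivity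
  set K : ℝ := (d + 1 : ℝ) ^ (2 * m) with hK
  have hK0 : 0 < K := by positivity
  set D : ℝ := K * (3 ^ d * (1 + d : ℝ) ^ J * 2 ^ (2 * m) * A + 1) with hD
  have hD0 : 0 < D := by positivity
  refine ⟨Real.sqrt D, Real.sqrt_pos.2 hD0, ?_⟩
  intro g M hg hp hM n hn
  have hM0 : 0 ≤ M := (norm_nonneg _).trans (hM 0 (by omega) 0)
  have hn1 : (1:ℝ) ≤ n := by exact_mod_cast hn
  have hn0 : (0:ℝ) < n := by linarith
  obtain ⟨hS, hSle⟩ := sobolev_bound hm0 hg hp hM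
  set S := ∑' k : Fin d → ℤ, (1 + latNormSq d k) ^ (2 * m) * ‖fourierCoeff' d g k‖ ^ 2 with hSdef
  have hS0 : 0 ≤ S := tsum_nonneg fun p => by have := hpos p; positivity
  set E := 2 ^ (2 * m) * (((n : ℝ) ^ 2) ^ (2 * m))⁻¹ * A with hE
  have hE0 : 0 ≤ E := by positivity
  have key : sobNormSq d J
      (fun k => exCoef d n (fun x => g (discPt d n x)) k - fourierCoeff' d g k)
      ≤ D * M ^ 2 / n ^ 2 := by
    set B : ℝ := ((1 + d : ℝ) * n ^ 2) ^ J * (E * S) with hB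
    have hB0 : 0 ≤ B := by positivity
    have hle : ∀ k, sobWeight d J k *
        ‖exCoef d n (fun x => g (discPt d n x)) k - fourierCoeff' d g k‖ ^ 2 ≤
        (if k ∈ cube d n then B else 0) +
          ((n:ℝ) ^ 2)⁻¹ * ((1 + latNormSq d k) ^ (2 * m) * ‖fourierCoeff' d g k‖ ^ 2) := by
      intro k
      have hk0 := hpos k
      by_cases hk : k ∈ cube d n
      · rw [if_pos hk]
        have hk' := (mem_cube_iff k).1 hk
        have h1 : sobWeight d J k ≤ ((1 + d : ℝ) * n ^ 2) ^ J := by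
          rw [sobWeight]
          refine Real.rpow_le_rpow hk0.le ?_ hJ
          have : latNormSq d k ≤ d * (n:ℝ) ^ 2 := by
            rw [latNormSq]
            calc _ ≤ ∑ j : Fin d, (n:ℝ) ^ 2 := by
                  refine Finset.sum_le_sum fun j _ => ?_
                  rw [sq_le_sq, Nat.abs_cast]
                  exact_mod_cast hk' j
              _ = _ := by simp
          nlinarith
        have h2 := wrap_err hn hg.continuous hp hA hS k hk'
        have h3 : sobWeight d J k *
            ‖exCoef d n (fun x => g (discPt d n x)) k - fourierCoeff' d g k‖ ^ 2 ≤ B :=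
          mul_le_mul h1 h2 (by positivity) (by positivity)
        have h4 : 0 ≤ ((n:ℝ) ^ 2)⁻¹ * ((1 + latNormSq d k) ^ (2 * m) * ‖fourierCoeff' d g k‖ ^ 2) := by
          positivity
        linarith
      · rw [if_neg hk, zero_add]
        have hk' : ¬ ∀ j, |k j| ≤ (n : ℤ) := fun h => hk ((mem_cube_iff k).2 h)
        have hex : exCoef d n (fun x => g (discPt d n x)) k = 0 := by
          rw [exCoef, if_neg hk']
        rw [hex, zero_sub, norm_neg, ← mul_assoc]
        refine mul_le_mul_of_nonneg_right ?_ (sq_nonneg _)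
        push Not at hk'
        obtain ⟨j, hj⟩ := hk'
        have h1 : (n:ℝ) ^ 2 ≤ 1 + latNormSq d k := by
          have a1 : (n:ℝ) ≤ |(k j : ℝ)| := by exact_mod_cast hj.le
          have a2 : (n:ℝ) ^ 2 ≤ (k j : ℝ) ^ 2 := by
            rw [← sq_abs (k j : ℝ)]
            gcongr
          linarith [sq_le_latNormSq k j]
        have h2 : (1:ℝ) ≤ 1 + latNormSq d k := by linarith [latNormSq_nonneg d k]
        rw [sobWeight]
        calc (1 + latNormSq d k) ^ J ≤ (1 + latNormSq d k) ^ (((2 * m : ℕ) : ℝ) + (-1)) := by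
              apply Real.rpow_le_rpow_of_exponent_le h2
              push_cast; linarith
          _ = (1 + latNormSq d k)⁻¹ * (1 + latNormSq d k) ^ (2 * m) := by
              rw [Real.rpow_add hk0, Real.rpow_natCast, Real.rpow_neg_one, mul_comm]
          _ ≤ _ := by gcongr
    have hfin : (cube d n).card * B ≤
        K * (3 ^ d * (1 + d : ℝ) ^ J * 2 ^ (2 * m) * A) * M ^ 2 / n ^ 2 := by
      have h1 : (n:ℝ) ^ d * ((n:ℝ) ^ 2) ^ J * (((n : ℝ) ^ 2) ^ (2 * m))⁻¹ ≤ ((n:ℝ) ^ 2)⁻¹ := by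
        have e1 : ((n:ℝ) ^ 2) ^ J = (n:ℝ) ^ (2 * J) := by
          rw [Real.rpow_mul hn0.le, Real.rpow_two]
        have e2 : (((n : ℝ) ^ 2) ^ (2 * m))⁻¹ = (n:ℝ) ^ (-(4 * m : ℝ)) := by
          rw [Real.rpow_neg hn0.le, ← pow_mul, ← Real.rpow_natCast]
          congr 2
          push_cast; ring
        have e3 : ((n:ℝ) ^ 2)⁻¹ = (n:ℝ) ^ (-2 : ℝ) := by
          rw [Real.rpow_neg hn0.le, Real.rpow_two]
        rw [e1, e2, e3, ← Real.rpow_natCast, ← Real.rpow_add hn0, ← Real.rpow_add hn0]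
        apply Real.rpow_le_rpow_of_exponent_le hn1
        linarith
      calc (cube d n).card * B ≤ (3 ^ d * (n : ℝ) ^ d) * B := by
            gcongr
            exact cube_card_le hn
        _ = (3 ^ d * (1 + d : ℝ) ^ J * 2 ^ (2 * m) * A * S) *
            ((n:ℝ) ^ d * ((n:ℝ) ^ 2) ^ J * (((n : ℝ) ^ 2) ^ (2 * m))⁻¹) := by
            rw [hB, hE, Real.mul_rpow (by positivity) (by positivity)]
            ring
        _ ≤ (3 ^ d * (1 + d : ℝ) ^ J * 2 ^ (2 * m) * A * (K * M ^ 2)) * ((n:ℝ) ^ 2)⁻¹ := by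
            gcongr
        _ = _ := by ring
    rw [sobNormSq]
    refine Real.tsum_le_of_sum_le (fun k => ?_) fun F => ?_
    · have : 0 ≤ sobWeight d J k := Real.rpow_nonneg (hpos k).le _
      simp only [Pi.zero_apply]
      positivity
    calc _ ≤ ∑ k ∈ F, ((if k ∈ cube d n then B else 0) +
          ((n:ℝ) ^ 2)⁻¹ * ((1 + latNormSq d k) ^ (2 * m) * ‖fourierCoeff' d g k‖ ^ 2)) :=
          Finset.sum_le_sum fun k _ => hle k
      _ = ∑ k ∈ F, (if k ∈ cube d n then B else 0) + ((n:ℝ) ^ 2)⁻¹ *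
          ∑ k ∈ F, ((1 + latNormSq d k) ^ (2 * m) * ‖fourierCoeff' d g k‖ ^ 2) := by
          rw [Finset.sum_add_distrib, Finset.mul_sum]
      _ ≤ (cube d n).card * B + ((n:ℝ) ^ 2)⁻¹ * S := by
          gcongr
          · rw [← Finset.sum_filter, Finset.sum_const, nsmul_eq_mul]
            gcongr
            intro k hk
            exact (Finset.mem_filter.1 hk).2
          · exact hS.sum_le_tsum _ fun p _ => by have := hpos p; positivity
      _ ≤ K * (3 ^ d * (1 + d : ℝ) ^ J * 2 ^ (2 * m) * A) * M ^ 2 / n ^ 2 +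
          ((n:ℝ) ^ 2)⁻¹ * (K * M ^ 2) := by gcongr
      _ = _ := by rw [hD]; ring
  rw [sobNorm]
  calc _ ≤ Real.sqrt (D * M ^ 2 / n ^ 2) := Real.sqrt_le_sqrt key
    _ = _ := by
      rw [Real.sqrt_div (by positivity), Real.sqrt_mul hD0.le, Real.sqrt_sq hM0, Real.sqrt_sq hn0.le]
      ring

end
end

section
/- For every f : T_n^d → [0,1] (or more generally bounded f) and n ≥ 1, ‖ex_n(f²) - (ex_n f)²‖_{L_2(T^d)} ≤ (C/n) ‖ex_n f‖²_{C^{⌈d/2⌉+4}}, where C depends only on d. -/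
open scoped BigOperators
open Real

noncomputable section

open MeasureTheory

/-- The trigonometric interpolation `ex_n f` as a function on `T^d` (realized on `ℝ^d`). -/
def exFun (d n : ℕ) (f : DTorus d n → ℂ) : (Fin d → ℝ) → ℂ :=
  fun y => ∑ k ∈ cube d n, exCoef d n f k * charFun d k y

/-- `L²(T^d)`-norm with respect to the normalized Lebesgue measure. -/
def l2Norm (d : ℕ) (h : (Fin d → ℝ) → ℂ) : ℝ :=
  Real.sqrt (((2 * π) ^ d)⁻¹ *
    ∫ y in Set.univ.pi fun _ : Fin d => Set.Icc (0 : ℝ) (2 * π), ‖h y‖ ^ 2)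

/-! ### Characters -/

lemma charFun_eq_prod (d : ℕ) (k : Fin d → ℤ) (y : Fin d → ℝ) :
    charFun d k y = ∏ j, Complex.exp (Complex.I * (k j : ℂ) * (y j : ℂ)) := by
  unfold _root_.charFun
  rw [← Complex.exp_sum]
  congr 1
  push_cast
  rw [Finset.mul_sum]
  exact Finset.sum_congr rfl fun j _ => by ring

lemma charFun_add (d : ℕ) (k l : Fin d → ℤ) (y : Fin d → ℝ) :
    charFun d (k + l) y = charFun d k y * charFun d l y := by
  simp only [charFun_eq_prod, ← Finset.prod_mul_distrib, ← Complex.exp_add]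
  refine Finset.prod_congr rfl fun j _ => ?_
  congr 1
  simp only [Pi.add_apply]
  push_cast
  ring

lemma charFun_conj (d : ℕ) (k : Fin d → ℤ) (y : Fin d → ℝ) :
    (starRingEnd ℂ) (charFun d k y) = charFun d (-k) y := by
  simp only [charFun_eq_prod, map_prod, ← Complex.exp_conj, map_mul, Complex.conj_I,
    Complex.conj_ofReal]
  refine Finset.prod_congr rfl fun j _ => ?_
  congr 1
  have : (starRingEnd ℂ) ((k j : ℤ) : ℂ) = ((k j : ℤ) : ℂ) := by simp
  rw [this]
  simp

lemma charFun_mul_conj (d : ℕ) (k l : Fin d → ℤ) (y : Fin d → ℝ) :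
    charFun d k y * (starRingEnd ℂ) (charFun d l y) = charFun d (k - l) y := by
  rw [charFun_conj, ← charFun_add, sub_eq_add_neg]

lemma continuous_charFun (d : ℕ) (k : Fin d → ℤ) : Continuous (charFun d k) := by
  unfold _root_.charFun
  fun_prop

/-- The linear form `v ↦ k·v`. -/
def linForm (d : ℕ) (k : Fin d → ℤ) : (Fin d → ℝ) →L[ℝ] ℂ :=
  Complex.ofRealCLM.comp (∑ j, (k j : ℝ) • ContinuousLinearMap.proj (R := ℝ) (φ := fun _ : Fin d => ℝ) j)

lemma linForm_apply (d : ℕ) (k : Fin d → ℤ) (y : Fin d → ℝ) :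
    linForm d k y = ((∑ j, (k j : ℝ) * y j : ℝ) : ℂ) := by
  simp [linForm]

lemma hasFDerivAt_charFun (d : ℕ) (k : Fin d → ℤ) (y : Fin d → ℝ) :
    HasFDerivAt (charFun d k) (charFun d k y • (Complex.I • linForm d k)) y := by
  have h := (((linForm d k).hasFDerivAt (x := y)).const_smul Complex.I).cexp
  have e : charFun d k = fun x => Complex.exp (Complex.I • linForm d k x) := by
    funext x
    rw [linForm_apply]
    simp [_root_.charFun]
  rw [e]
  exact h

/-! ### Orthogonality on the discrete torus -/

/-- The root of unity `exp(2πi a/(2n+1))`. -/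
def zt (n : ℕ) (a : ℤ) : ℂ := Complex.exp (Complex.I * a * (2 * π / (2 * (n : ℂ) + 1)))

lemma nz (n : ℕ) : (2 * (n : ℂ) + 1) ≠ 0 := by
  have : ((2 * n + 1 : ℕ) : ℂ) ≠ 0 := Nat.cast_ne_zero.2 (Nat.succ_ne_zero (2 * n))
  simpa using this

lemma zt_pow_card (n : ℕ) (a : ℤ) : zt n a ^ (2 * n + 1) = 1 := by
  unfold zt
  rw [← Complex.exp_nat_mul, Complex.exp_eq_one_iff]
  refine ⟨a, ?_⟩
  have := nz n
  push_cast
  field_simp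

lemma zt_eq_one_iff (n : ℕ) (a : ℤ) : zt n a = 1 ↔ ((2 * n + 1 : ℕ) : ℤ) ∣ a := by
  unfold zt
  rw [Complex.exp_eq_one_iff]
  have h0 := nz n
  have hpi : (π : ℂ) ≠ 0 := by exact_mod_cast Real.pi_ne_zero
  constructor
  · rintro ⟨b, hb⟩
    refine ⟨b, ?_⟩
    have : (a : ℂ) = (2 * n + 1) * b := by
      field_simp at hb
      have hI := Complex.I_ne_zero
      linear_combination hb
    exact_mod_cast this
  · rintro ⟨b, rfl⟩
    refine ⟨b, ?_⟩
    push_cast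
    field_simp

lemma zt_geom (n : ℕ) (a : ℤ) : ∑ i ∈ Finset.range (2 * n + 1), zt n a ^ i =
    if ((2 * n + 1 : ℕ) : ℤ) ∣ a then (2 * (n : ℂ) + 1) else 0 := by
  split_ifs with h
  · rw [← zt_eq_one_iff] at h
    simp [h]
  · rw [← zt_eq_one_iff] at h
    rw [geom_sum_eq h, zt_pow_card]
    simp

lemma zt_ne_zero (n : ℕ) (a : ℤ) : zt n a ≠ 0 := Complex.exp_ne_zero _

lemma zt_geom_int (n : ℕ) (a : ℤ) : ∑ i ∈ Finset.Icc (-(n : ℤ)) n, zt n a ^ i =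
    if ((2 * n + 1 : ℕ) : ℤ) ∣ a then (2 * (n : ℂ) + 1) else 0 := by
  have h : ∑ i ∈ Finset.Icc (-(n : ℤ)) n, zt n a ^ i =
      zt n a ^ (-(n : ℤ)) * ∑ i ∈ Finset.range (2 * n + 1), zt n a ^ i := by
    rw [Finset.mul_sum]
    symm
    refine Finset.sum_bij' (fun i _ => (i : ℤ) - n) (fun k _ => (k + n).toNat) ?_ ?_ ?_ ?_ ?_
    · intro i hi
      simp only [Finset.mem_range, Finset.mem_Icc] at *
      omega
    · intro i hi
      simp only [Finset.mem_range, Finset.mem_Icc] at *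
      omega
    · intro i hi
      simp
    · intro i hi
      simp only [Finset.mem_range, Finset.mem_Icc] at *
      omega
    · intro i hi
      rw [← zpow_natCast, ← zpow_add₀ (zt_ne_zero n a)]
      congr 1
      ring
  rw [h, zt_geom]
  split_ifs with hd
  · rw [(zt_eq_one_iff n a).2 hd]
    simp
  · simp

lemma charFun_discPt (d n : ℕ) (k : Fin d → ℤ) (x : DTorus d n) :
    charFun d k (discPt d n x) = ∏ j, zt n (k j) ^ (x j).val := by
  rw [charFun_eq_prod]
  refine Finset.prod_congr rfl fun j _ => ?_
  unfold zt discPt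
  rw [← Complex.exp_nat_mul]
  congr 1
  push_cast
  ring

lemma charFun_discPt_sub (d n : ℕ) (k : Fin d → ℤ) (x x' : DTorus d n) :
    charFun d k (discPt d n x') * (starRingEnd ℂ) (charFun d k (discPt d n x)) =
      ∏ j, zt n (((x' j).val : ℤ) - (x j).val) ^ (k j) := by
  rw [charFun_conj, charFun_eq_prod, charFun_eq_prod, ← Finset.prod_mul_distrib]
  refine Finset.prod_congr rfl fun j _ => ?_
  unfold zt discPt
  rw [← Complex.exp_int_mul, ← Complex.exp_add]
  congr 1
  simp only [Pi.neg_apply]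
  push_cast
  ring

lemma prod_ite_const {d : ℕ} (p : Fin d → Prop) [DecidablePred p] [Decidable (∀ j, p j)] (c : ℂ) :
    (∏ j, if p j then c else 0) = if ∀ j, p j then c ^ d else 0 := by
  split_ifs with h
  · simp [h]
  · push Not at h
    obtain ⟨j, hj⟩ := h
    exact Finset.prod_eq_zero (Finset.mem_univ j) (by simp [hj])

open Classical in
lemma disc_orth (d n : ℕ) (m : Fin d → ℤ) :
    ∑ x : DTorus d n, charFun d m (discPt d n x) =
      if ∀ j, ((2 * n + 1 : ℕ) : ℤ) ∣ m j then (2 * (n : ℂ) + 1) ^ d else 0 := by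
  simp only [charFun_discPt]
  have h := Finset.prod_univ_sum (fun _ : Fin d => (Finset.univ : Finset (ZMod (2 * n + 1))))
    (fun j x => zt n (m j) ^ x.val)
  rw [Fintype.piFinset_univ] at h
  rw [← h, ← prod_ite_const]
  refine Finset.prod_congr rfl fun j _ => ?_
  rw [← zt_geom]
  exact Fin.sum_univ_eq_sum_range (fun i => zt n (m j) ^ i) (2 * n + 1)

open Classical in
lemma disc_orth_dual (d n : ℕ) (x x' : DTorus d n) :
    ∑ k ∈ cube d n, charFun d k (discPt d n x') * (starRingEnd ℂ) (charFun d k (discPt d n x)) =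
      if x = x' then (2 * (n : ℂ) + 1) ^ d else 0 := by
  simp only [charFun_discPt_sub, cube]
  have h := Finset.prod_univ_sum (fun _ : Fin d => Finset.Icc (-(n : ℤ)) n)
    (fun j k => zt n (((x' j).val : ℤ) - (x j).val) ^ k)
  rw [← h]
  simp only [zt_geom_int]
  rw [prod_ite_const]
  congr 1
  rw [eq_iff_iff]
  constructor
  · intro h
    funext j
    have h1 := ZMod.val_lt (x j)
    have h2 := ZMod.val_lt (x' j)
    have h3 := Int.eq_zero_of_abs_lt_dvd (h j) (by rw [abs_lt]; constructor <;> omega)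
    apply ZMod.val_injective
    omega
  · rintro rfl j
    simp

lemma mem_cube {d n : ℕ} {k : Fin d → ℤ} : k ∈ cube d n ↔ ∀ j, |k j| ≤ (n : ℤ) := by
  simp [cube, abs_le]

lemma exFun_discPt (d n : ℕ) (f : DTorus d n → ℂ) (x' : DTorus d n) :
    exFun d n f (discPt d n x') = f x' := by
  classical
  have h : ∀ k ∈ cube d n, exCoef d n f k * charFun d k (discPt d n x') =
      ∑ x, ((2 * (n : ℂ) + 1) ^ d)⁻¹ * f x * (charFun d k (discPt d n x') *
        (starRingEnd ℂ) (charFun d k (discPt d n x))) := by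
    intro k hk
    rw [exCoef, if_pos (mem_cube.1 hk), dInner, Finset.mul_sum, Finset.sum_mul]
    refine Finset.sum_congr rfl fun x _ => ?_
    push_cast
    ring
  unfold exFun
  rw [Finset.sum_congr rfl h, Finset.sum_comm]
  simp only [← Finset.mul_sum, disc_orth_dual]
  have := pow_ne_zero d (nz n)
  simp
  field_simp

open Classical in
lemma exCoef_trig (d n : ℕ) (S : Finset (Fin d → ℤ)) (g : (Fin d → ℤ) → ℂ) (k : Fin d → ℤ)
    (hk : k ∈ cube d n) :
    exCoef d n (fun x => ∑ m ∈ S, g m * charFun d m (discPt d n x)) k =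
      ∑ m ∈ S with ∀ j, ((2 * n + 1 : ℕ) : ℤ) ∣ m j - k j, g m := by
  rw [exCoef, if_pos (mem_cube.1 hk), dInner]
  simp only [Finset.sum_mul, mul_assoc, charFun_mul_conj]
  rw [Finset.sum_comm]
  simp only [← Finset.mul_sum, disc_orth]
  rw [Finset.mul_sum, Finset.sum_filter]
  refine Finset.sum_congr rfl fun m _ => ?_
  have := pow_ne_zero d (nz n)
  simp only [Pi.sub_apply]
  split_ifs
  · push_cast
    field_simp
  · simp

/-! ### Parseval -/

lemma int_exp (m : ℤ) : ∫ y in Set.Icc (0 : ℝ) (2 * π), Complex.exp (Complex.I * m * y) =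
    if m = 0 then (2 * π : ℂ) else 0 := by
  rw [integral_Icc_eq_integral_Ioc, ← intervalIntegral.integral_of_le (by positivity)]
  split_ifs with h
  · simp [h]
  · rw [integral_exp_mul_complex (by simp [h])]
    have : Complex.exp (Complex.I * m * ((2 * π : ℝ) : ℂ)) = 1 := by
      rw [Complex.exp_eq_one_iff]
      exact ⟨m, by push_cast; ring⟩
    rw [this]
    simp

/-- The box `[0,2π]^d`. -/
def box (d : ℕ) : Set (Fin d → ℝ) := Set.univ.pi fun _ : Fin d => Set.Icc (0 : ℝ) (2 * π)

lemma isCompact_box (d : ℕ) : IsCompact (box d) := isCompact_univ_pi fun _ => isCompact_Icc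

lemma int_charFun (d : ℕ) (m : Fin d → ℤ) : ∫ y in box d, charFun d m y =
    if m = 0 then (2 * π : ℂ) ^ d else 0 := by
  classical
  simp only [charFun_eq_prod]
  unfold box
  rw [volume_pi, Measure.restrict_pi_pi,
    integral_fintype_prod_eq_prod (fun j y => Complex.exp (Complex.I * (m j : ℂ) * ((y : ℝ) : ℂ)))]
  simp only [int_exp]
  rw [prod_ite_const]
  simp only [funext_iff, Pi.zero_apply]

lemma parseval (d : ℕ) (S : Finset (Fin d → ℤ)) (a : (Fin d → ℤ) → ℂ) :
    ∫ y in box d, ‖∑ m ∈ S, a m * charFun d m y‖ ^ 2 = (2 * π) ^ d * ∑ m ∈ S, ‖a m‖ ^ 2 := by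
  have key : ∀ y, ((‖∑ m ∈ S, a m * charFun d m y‖ ^ 2 : ℝ) : ℂ) =
      ∑ m ∈ S, ∑ k ∈ S, (a m * (starRingEnd ℂ) (a k)) * charFun d (m - k) y := by
    intro y
    push_cast
    rw [← Complex.mul_conj', map_sum, Finset.sum_mul_sum]
    refine Finset.sum_congr rfl fun m _ => Finset.sum_congr rfl fun k _ => ?_
    rw [← charFun_mul_conj, map_mul]
    ring
  have hInt : ∀ m : Fin d → ℤ, ∀ c : ℂ, Integrable (fun y => c * charFun d m y)
      (volume.restrict (box d)) := fun m c =>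
    ((continuous_const.mul (continuous_charFun d m)).continuousOn).integrableOn_compact
      (isCompact_box d)
  have : ((∫ y in box d, ‖∑ m ∈ S, a m * charFun d m y‖ ^ 2 : ℝ) : ℂ) =
      (((2 * π) ^ d * ∑ m ∈ S, ‖a m‖ ^ 2 : ℝ) : ℂ) := by
    rw [← integral_complex_ofReal]
    simp only [key]
    rw [integral_finsetSum _ fun m _ => integrable_finsetSum _ fun k _ => hInt _ _]
    push_cast
    rw [Finset.mul_sum]
    refine Finset.sum_congr rfl fun m hm => ?_
    rw [integral_finsetSum _ fun k _ => hInt _ _]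
    simp only [integral_const_mul, int_charFun, sub_eq_zero]
    simp [hm, ← Complex.mul_conj']
    ring
  exact_mod_cast this

/-! ### The square of a trigonometric polynomial -/

/-- Fourier coefficients of the square of a trigonometric polynomial. -/
def sqCoef (d n : ℕ) (c : (Fin d → ℤ) → ℂ) (m : Fin d → ℤ) : ℂ :=
  ∑ p ∈ cube d n ×ˢ cube d n with p.1 + p.2 = m, c p.1 * c p.2

lemma sq_trig (d n : ℕ) (c : (Fin d → ℤ) → ℂ) (y : Fin d → ℝ) :
    (∑ k ∈ cube d n, c k * charFun d k y) ^ 2 =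
      ∑ m ∈ cube d (2 * n), sqCoef d n c m * charFun d m y := by
  rw [sq, Finset.sum_mul_sum, ← Finset.sum_product']
  rw [← Finset.sum_fiberwise_of_maps_to (t := cube d (2 * n)) (g := fun p => p.1 + p.2)]
  · refine Finset.sum_congr rfl fun m _ => ?_
    rw [sqCoef, Finset.sum_mul]
    refine Finset.sum_congr rfl fun p hp => ?_
    rw [← (Finset.mem_filter.1 hp).2, charFun_add]
    ring
  · intro p hp
    obtain ⟨h1, h2⟩ := Finset.mem_product.1 hp
    rw [mem_cube] at *
    intro j
    have := h1 j
    have := h2 j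
    have := abs_add_le (p.1 j) (p.2 j)
    simp only [Pi.add_apply]
    push_cast
    linarith

lemma hasFDerivAt_trig (d : ℕ) (S : Finset (Fin d → ℤ)) (a : (Fin d → ℤ) → ℂ) (y : Fin d → ℝ) :
    HasFDerivAt (fun y => ∑ m ∈ S, a m * charFun d m y)
      (∑ m ∈ S, a m • (charFun d m y • (Complex.I • linForm d m))) y :=
  HasFDerivAt.fun_sum fun m _ => (hasFDerivAt_charFun d m y).const_mul (a m)

lemma deriv_bound (d : ℕ) (S T : Finset (Fin d → ℤ)) (c g : (Fin d → ℤ) → ℂ) (M : ℝ)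
    (F : (Fin d → ℝ) → ℂ) (hF : F = fun y => ∑ k ∈ T, c k * charFun d k y)
    (hsq : ∀ y, F y ^ 2 = ∑ m ∈ S, g m * charFun d m y)
    (h0 : ∀ y, ‖F y‖ ≤ M) (h1 : ∀ y, ‖fderiv ℝ F y‖ ≤ M) (j : Fin d) :
    ∑ m ∈ S, (m j : ℝ) ^ 2 * ‖g m‖ ^ 2 ≤ 4 * M ^ 4 := by
  have hM : 0 ≤ M := (norm_nonneg _).trans (h0 0)
  have hd : ∀ y, HasFDerivAt F (fderiv ℝ F y) y := fun y =>
    DifferentiableAt.hasFDerivAt (by rw [hF]; exact (hasFDerivAt_trig d T c y).differentiableAt)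
  have hpt : ∀ y, ‖∑ m ∈ S, (g m * (Complex.I * (m j : ℂ))) * charFun d m y‖ ≤ 2 * M ^ 2 := by
    intro y
    have e1 := (hd y).mul (hd y)
    have e2 := hasFDerivAt_trig d S g y
    have e3 : (F * F) = fun y => ∑ m ∈ S, g m * charFun d m y := by
      funext y
      rw [← hsq, sq]
      rfl
    rw [e3] at e1
    have e4 := congrArg (fun L => L (Pi.single j (1 : ℝ))) (e2.unique e1)
    have e5 : ∑ m ∈ S, (g m * (Complex.I * (m j : ℂ))) * charFun d m y =
        2 * (F y * fderiv ℝ F y (Pi.single j 1)) := by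
      have : ∀ m : Fin d → ℤ, linForm d m (Pi.single j 1) = (m j : ℂ) := by
        intro m
        rw [linForm_apply]
        simp [Pi.single_apply]
      simp [this] at e4
      rw [two_mul, ← e4]
      exact Finset.sum_congr rfl fun m _ => by ring
    rw [e5]
    have e6 : ‖fderiv ℝ F y (Pi.single j 1)‖ ≤ M := by
      have := (fderiv ℝ F y).le_opNorm (Pi.single j (1 : ℝ))
      rw [Pi.norm_single] at this
      simp at this
      exact this.trans (h1 y)
    rw [norm_mul, norm_mul]
    have := mul_le_mul (h0 y) e6 (norm_nonneg _) hM
    simp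
    nlinarith
  have hp := parseval d S (fun m => g m * (Complex.I * (m j : ℂ)))
  have hc := parseval d {0} (fun _ => ((2 * M ^ 2 : ℝ) : ℂ))
  have hle : ∫ y in box d, ‖∑ m ∈ S, (g m * (Complex.I * (m j : ℂ))) * charFun d m y‖ ^ 2 ≤
      ∫ y in box d, ‖∑ m ∈ ({0} : Finset (Fin d → ℤ)), ((2 * M ^ 2 : ℝ) : ℂ) * charFun d m y‖ ^ 2 := by
    have hcont : ∀ (S : Finset (Fin d → ℤ)) (a : (Fin d → ℤ) → ℂ),
        IntegrableOn (fun y => ‖∑ m ∈ S, a m * charFun d m y‖ ^ 2) (box d) := by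
      intro S a
      refine ContinuousOn.integrableOn_compact (isCompact_box d) (Continuous.continuousOn ?_)
      exact (continuous_finsetSum _ fun m _ =>
        continuous_const.mul (continuous_charFun d m)).norm.pow 2
    refine integral_mono (hcont S _) (hcont {0} _) fun y => ?_
    have e : charFun d 0 y = 1 := by simp [charFun_eq_prod]
    simp only [Finset.sum_singleton, e, mul_one]
    rw [Complex.norm_real, Real.norm_of_nonneg (by positivity)]
    exact pow_le_pow_left₀ (norm_nonneg _) (hpt y) 2
  rw [hp, hc] at hle
  have hle2 := le_of_mul_le_mul_left hle (by positivity)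
  rw [Finset.sum_singleton, Complex.norm_real, Real.norm_of_nonneg (by positivity)] at hle2
  calc _ = ∑ m ∈ S, ‖g m * (Complex.I * (m j : ℂ))‖ ^ 2 := by
        refine Finset.sum_congr rfl fun m _ => ?_
        simp [mul_pow]
        ring
    _ ≤ _ := hle2
    _ = _ := by ring

/-! ### Aliasing -/

/-- Congruence modulo `2n+1`. -/
def Cong (d n : ℕ) (m k : Fin d → ℤ) : Prop := ∀ j, ((2 * n + 1 : ℕ) : ℤ) ∣ m j - k j

open Classical in
lemma card_fiber (d n : ℕ) (k : Fin d → ℤ) (hk : k ∈ cube d n) :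
    ((cube d (2 * n)).filter fun m => Cong d n m k).card ≤ 3 ^ d := by
  have hsub : ((cube d (2 * n)).filter fun m => Cong d n m k) ⊆
      Fintype.piFinset fun j => ({k j - (2 * n + 1), k j, k j + (2 * n + 1)} : Finset ℤ) := by
    intro m hm
    obtain ⟨h1, h2⟩ := Finset.mem_filter.1 hm
    rw [mem_cube] at h1 hk
    rw [Fintype.mem_piFinset]
    intro j
    have h1 := abs_le.1 (h1 j)
    have h3 := abs_le.1 (hk j)
    obtain ⟨q, hq⟩ := h2 j
    push_cast at hq h1
    have hq1 : q < 2 := by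
      by_contra hc
      have : 2 ≤ q := by omega
      nlinarith
    have hq2 : -2 < q := by
      by_contra hc
      have : q ≤ -2 := by omega
      nlinarith
    simp only [Finset.mem_insert, Finset.mem_singleton]
    have : q = -1 ∨ q = 0 ∨ q = 1 := by omega
    rcases this with rfl | rfl | rfl
    · left; linarith
    · right; left; linarith
    · right; right; linarith
  refine (Finset.card_le_card hsub).trans ?_
  rw [Fintype.card_piFinset]
  refine (Finset.prod_le_pow_card _ _ 3 fun j _ => Finset.card_le_three).trans ?_
  simp

lemma cong_unique {d n : ℕ} {k l m : Fin d → ℤ} (hk : k ∈ cube d n) (hl : l ∈ cube d n)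
    (h1 : Cong d n m k) (h2 : Cong d n m l) : k = l := by
  rw [mem_cube] at hk hl
  funext j
  have a1 := abs_le.1 (hk j)
  have a2 := abs_le.1 (hl j)
  have h3 := dvd_sub (h1 j) (h2 j)
  have := Int.eq_zero_of_abs_lt_dvd h3 (by rw [abs_lt]; constructor <;> push_cast <;> linarith)
  linarith

lemma cube_mono {d n : ℕ} : cube d n ⊆ cube d (2 * n) := by
  intro k hk
  rw [mem_cube] at *
  intro j
  have := hk j
  push_cast
  omega

open Classical in
lemma alias_bound (d n : ℕ) (g : (Fin d → ℤ) → ℂ) :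
    ∑ k ∈ cube d (2 * n), ‖(if k ∈ cube d n then
        ∑ m ∈ cube d (2 * n) with Cong d n m k, g m else 0) - g k‖ ^ 2 ≤
      (3 ^ d + 1) * ∑ m ∈ cube d (2 * n) \ cube d n, ‖g m‖ ^ 2 := by
  set B := cube d (2 * n) \ cube d n with hB
  rw [← Finset.sum_sdiff cube_mono, ← hB, add_mul, one_mul, add_comm]
  refine add_le_add ?_ (le_of_eq ?_)
  swap
  · refine Finset.sum_congr rfl fun k hk => ?_
    rw [if_neg (Finset.mem_sdiff.1 hk).2]
    simp
  have hk1 : ∀ k ∈ cube d n, ‖(if k ∈ cube d n then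
        ∑ m ∈ cube d (2 * n) with Cong d n m k, g m else 0) - g k‖ ^ 2 ≤
      3 ^ d * ∑ m ∈ B with Cong d n m k, ‖g m‖ ^ 2 := by
    intro k hk
    rw [if_pos hk]
    have hself : Cong d n k k := fun j => by simp
    have e : ((cube d (2 * n)).filter fun m => Cong d n m k) =
        insert k (B.filter fun m => Cong d n m k) := by
      ext m
      simp only [Finset.mem_filter, Finset.mem_insert, hB, Finset.mem_sdiff]
      constructor
      · rintro ⟨h1, h2⟩
        by_cases hm : m ∈ cube d n
        · left
          exact cong_unique hm hk (fun j => by simp) h2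
        · right
          exact ⟨⟨h1, hm⟩, h2⟩
      · rintro (rfl | ⟨⟨h1, _⟩, h2⟩)
        · exact ⟨cube_mono hk, hself⟩
        · exact ⟨h1, h2⟩
    have hcard := card_fiber d n k hk
    have hsub : (B.filter fun m => Cong d n m k).card ≤ 3 ^ d := by
      refine le_trans (Finset.card_le_card ?_) hcard
      rw [e]
      exact Finset.subset_insert _ _
    rw [e, Finset.sum_insert (by simp [hB, hk]), add_sub_cancel_left]
    calc _ ≤ (∑ m ∈ B with Cong d n m k, ‖g m‖) ^ 2 :=
          pow_le_pow_left₀ (norm_nonneg _) (norm_sum_le _ _) 2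
      _ ≤ _ := sq_sum_le_card_mul_sum_sq
      _ ≤ _ := by
          refine mul_le_mul_of_nonneg_right (by exact_mod_cast hsub) ?_
          exact Finset.sum_nonneg fun _ _ => by positivity
  refine (Finset.sum_le_sum hk1).trans ?_
  rw [← Finset.mul_sum]
  refine mul_le_mul_of_nonneg_left ?_ (by positivity)
  simp only [Finset.sum_filter]
  rw [Finset.sum_comm]
  refine Finset.sum_le_sum fun m _ => ?_
  by_cases h : ∃ k ∈ cube d n, Cong d n m k
  · obtain ⟨k, hk, hmk⟩ := h
    rw [Finset.sum_eq_single_of_mem k hk]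
    · simp [hmk]
    · intro l hl hlk
      rw [if_neg]
      exact fun hml => hlk (cong_unique hl hk hml hmk)
  · push Not at h
    rw [Finset.sum_eq_zero fun k hk => if_neg (h k hk)]
    positivity

lemma tail_bound (d n : ℕ) (g : (Fin d → ℤ) → ℂ) (K : ℝ)
    (h : ∀ j, ∑ m ∈ cube d (2 * n), (m j : ℝ) ^ 2 * ‖g m‖ ^ 2 ≤ K) :
    (n : ℝ) ^ 2 * ∑ m ∈ cube d (2 * n) \ cube d n, ‖g m‖ ^ 2 ≤ d * K := by
  calc _ ≤ ∑ m ∈ cube d (2 * n) \ cube d n, ∑ j, (m j : ℝ) ^ 2 * ‖g m‖ ^ 2 := by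
        rw [Finset.mul_sum]
        refine Finset.sum_le_sum fun m hm => ?_
        have hm2 := (Finset.mem_sdiff.1 hm).2
        rw [mem_cube] at hm2
        push Not at hm2
        obtain ⟨j, hj⟩ := hm2
        refine le_trans ?_ (Finset.single_le_sum
          (f := fun j => (m j : ℝ) ^ 2 * ‖g m‖ ^ 2) (fun i _ => by positivity) (Finset.mem_univ j))
        refine mul_le_mul_of_nonneg_right ?_ (by positivity)
        rw [← sq_abs (m j : ℝ)]
        refine pow_le_pow_left₀ (by positivity) ?_ 2
        exact_mod_cast hj.le
    _ ≤ ∑ m ∈ cube d (2 * n), ∑ j, (m j : ℝ) ^ 2 * ‖g m‖ ^ 2 :=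
        Finset.sum_le_sum_of_subset_of_nonneg Finset.sdiff_subset fun m _ _ =>
          Finset.sum_nonneg fun j _ => by positivity
    _ = ∑ j, ∑ m ∈ cube d (2 * n), (m j : ℝ) ^ 2 * ‖g m‖ ^ 2 := Finset.sum_comm
    _ ≤ ∑ _j : Fin d, K := Finset.sum_le_sum fun j _ => h j
    _ = _ := by simp

/-- For every bounded `f : T_n^d → ℝ` (in particular `[0,1]`-valued `f`) and `n ≥ 1`,
`‖ex_n(f²) - (ex_n f)²‖_{L²(T^d)} ≤ (C/n) ‖ex_n f‖²_{C^{⌈d/2⌉+4}}`, where `C` depends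
only on `d`; the `C^{⌈d/2⌉+4}`-norm of `ex_n f` is encoded by a bound `M` on all its
derivatives up to order `⌈d/2⌉+4`. -/
theorem ex_of_square_error (d : ℕ) :
    ∃ C > 0, ∀ (n : ℕ), 1 ≤ n → ∀ (f : DTorus d n → ℝ) (M : ℝ),
      (∀ i ≤ (d + 1) / 2 + 4, ∀ y,
          ‖iteratedFDeriv ℝ i (exFun d n (fun x => ((f x : ℝ) : ℂ))) y‖ ≤ M) →
      l2Norm d
          (fun y => exFun d n (fun x => ((f x ^ 2 : ℝ) : ℂ)) y
            - (exFun d n (fun x => ((f x : ℝ) : ℂ)) y) ^ 2)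
        ≤ C / n * M ^ 2 := by
  classical
  refine ⟨2 * (3 ^ d + 1) * (d + 1), by positivity, ?_⟩
  intro n hn f M hM
  set c := exCoef d n (fun x => ((f x : ℝ) : ℂ)) with hc
  set F := exFun d n (fun x => ((f x : ℝ) : ℂ)) with hF
  set g := sqCoef d n c with hg
  have h0 : ∀ y, ‖F y‖ ≤ M := fun y => by
    have := hM 0 (by omega) y
    rwa [norm_iteratedFDeriv_zero] at this
  have h1 : ∀ y, ‖fderiv ℝ F y‖ ≤ M := fun y => by
    have := hM 1 (by omega) y
    rwa [norm_iteratedFDeriv_one] at this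
  have hM0 : 0 ≤ M := (norm_nonneg _).trans (h0 0)
  have hsq : ∀ y, F y ^ 2 = ∑ m ∈ cube d (2 * n), g m * charFun d m y := fun y => sq_trig d n c y
  have hD := fun j => deriv_bound d (cube d (2 * n)) (cube d n) c g M F rfl hsq h0 h1 j
  have hT := tail_bound d n g _ hD
  have hA := alias_bound d n g
  -- Fourier coefficients of the interpolation of the square
  have hf2 : (fun x : DTorus d n => ((f x ^ 2 : ℝ) : ℂ)) =
      fun x => ∑ m ∈ cube d (2 * n), g m * charFun d m (discPt d n x) := by
    funext x
    rw [← hsq, hF, exFun_discPt]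
    push_cast
    rfl
  have herr : ∀ y, exFun d n (fun x => ((f x ^ 2 : ℝ) : ℂ)) y - F y ^ 2 =
      ∑ k ∈ cube d (2 * n), ((if k ∈ cube d n then
        ∑ m ∈ cube d (2 * n) with Cong d n m k, g m else 0) - g k) * charFun d k y := by
    intro y
    simp only [sub_mul, Finset.sum_sub_distrib]
    rw [← hsq, hf2]
    congr 1
    simp only [ite_mul, zero_mul]
    rw [← Finset.sum_filter, Finset.filter_mem_eq_inter, Finset.inter_eq_right.2 cube_mono]
    unfold exFun
    refine Finset.sum_congr rfl fun k hk => ?_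
    rw [exCoef_trig d n _ g k hk]
    congr 1
    refine Finset.sum_congr ?_ fun _ _ => rfl
    ext m
    rw [Finset.mem_filter, Finset.mem_filter]
    exact Iff.rfl
  simp only [herr]
  have hP := parseval d (cube d (2 * n)) (fun k => (if k ∈ cube d n then
        ∑ m ∈ cube d (2 * n) with Cong d n m k, g m else 0) - g k)
  unfold l2Norm
  unfold box at hP
  rw [hP, inv_mul_cancel_left₀ (by positivity)]
  have hn0 : (0 : ℝ) < n := by exact_mod_cast hn
  refine Real.sqrt_le_iff.2 ⟨by positivity, hA.trans ?_⟩
  set R := ∑ m ∈ cube d (2 * n) \ cube d n, ‖g m‖ ^ 2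
  have e : (2 * (3 ^ d + 1) * (d + 1) / (n : ℝ) * M ^ 2) ^ 2 =
      ((3 ^ d + 1) ^ 2 * (d + 1) ^ 2 * (4 * M ^ 4)) / (n : ℝ) ^ 2 := by
    field_simp
    ring
  rw [e, le_div_iff₀ (by positivity)]
  have hX : (1 : ℝ) ≤ 3 ^ d + 1 := by
    have : (0 : ℝ) < 3 ^ d := by positivity
    linarith
  have hd0 : (0 : ℝ) ≤ d := by positivity
  calc (3 ^ d + 1) * R * (n : ℝ) ^ 2 = (3 ^ d + 1) * ((n : ℝ) ^ 2 * R) := by ring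
    _ ≤ (3 ^ d + 1) * (d * (4 * M ^ 4)) := mul_le_mul_of_nonneg_left hT (by positivity)
    _ = ((3 ^ d + 1) * d) * (4 * M ^ 4) := by ring
    _ ≤ _ := by
        refine mul_le_mul_of_nonneg_right ?_ (by positivity)
        refine mul_le_mul ?_ ?_ hd0 (by positivity)
        · nlinarith
        · nlinarith

end
end
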